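/- arXiv:2511.22347 — 10 statements merged into one kernel-verified Lean document; each statement's English description precedes it below -/
import Mathlib

section
/- For every t ∈ ℝ ∖ {0,1}, the exparabola p_t is tangent to the three side lines of the triangle ABC: p_t(0) = B2, and the derivative p_t'(0) is a nonzero scalar multiple of A − C (so the tangent at u = 0 is the line CA); p_t(1) = A0, and p_t'(1) is a nonzero scalar multiple of C − B (so the tangent at u = 1 is the line BC); and p_t(t) = (1−t)·A + t·B =: C1, with p_t'(t) a nonzero scalar multiple of B − A (so the tangent at u = t is the line AB, touching it at C1). -/
/-!
STATEMENT 0: For every `t ∈ ℝ ∖ {0,1}`, the exparabola `p_t` is tangent to the three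
side lines of the triangle `ABC`: `p_t 0 = B2` with tangent direction `A - C`,
`p_t 1 = A0` with tangent direction `C - B`, and `p_t t = C1 = (1-t)·A + t·B` with
tangent direction `B - A`.
-/

theorem hasDerivAt_quadraticBezier {E : Type*} [NormedAddCommGroup E] [NormedSpace ℝ E]
    (P Q R : E) (u : ℝ) :
    HasDerivAt (fun u : ℝ => (1 - u) ^ 2 • P + (2 * (1 - u) * u) • Q + u ^ 2 • R)
      ((2 * (1 - u)) • (Q - P) + (2 * u) • (R - Q)) u := by
  have hid := hasDerivAt_id' u
  have hsub := hid.const_sub 1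
  refine ((((hsub.fun_pow 2).smul_const P).add
    (((hsub.const_mul 2).fun_mul hid).smul_const Q)).add
    ((hid.fun_pow 2).smul_const R)).congr_deriv ?_
  match_scalars <;> norm_num <;> ring

theorem exparabola_tangent_to_sides
    (c c1 c2 : ℝ) (hc : 0 < c) (hc2 : 0 < c2)
    (A B C : ℝ × ℝ) (hA : A = (0, 0)) (hB : B = (c, 0)) (hC : C = (c1, c2))
    (t : ℝ) (ht0 : t ≠ 0) (ht1 : t ≠ 1)
    (B2 A0 C1 : ℝ × ℝ)
    (hB2 : B2 = (1 / (1 - t)) • (A - t • C))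
    (hA0 : A0 = (1 / t) • (B + (t - 1) • C))
    (hC1 : C1 = (1 - t) • A + t • B)
    (p : ℝ → ℝ × ℝ)
    (hp : ∀ u : ℝ, p u = (1 - u) ^ 2 • B2 + (2 * (1 - u) * u) • C + u ^ 2 • A0) :
    (p 0 = B2 ∧ ∃ k : ℝ, k ≠ 0 ∧ HasDerivAt p (k • (A - C)) 0) ∧
    (p 1 = A0 ∧ ∃ k : ℝ, k ≠ 0 ∧ HasDerivAt p (k • (C - B)) 1) ∧
    (p t = C1 ∧ ∃ k : ℝ, k ≠ 0 ∧ HasDerivAt p (k • (B - A)) t) := by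
  have h_one_sub : 1 - t ≠ 0 := sub_ne_zero.mpr ht1.symm
  have hCB2 : C - B2 = (1 / (1 - t)) • (C - A) := by
    rw [hB2]; match_scalars <;> field_simp <;> ring
  have hA0C : A0 - C = (1 / t) • (B - C) := by
    rw [hA0]; match_scalars <;> field_simp <;> ring
  have hp_deriv (u : ℝ) : HasDerivAt p
      ((2 * (1 - u)) • (1 / (1 - t)) • (C - A) + (2 * u) • (1 / t) • (B - C)) u := by
    rw [funext hp, ← hCB2, ← hA0C]
    exact hasDerivAt_quadraticBezier B2 C A0 u
  refine ⟨⟨by simp [hp], -2 / (1 - t), div_ne_zero (by norm_num) h_one_sub, ?_⟩,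
    ⟨by simp [hp], -2 / t, div_ne_zero (by norm_num) ht0, ?_⟩, ?_, 2, two_ne_zero, ?_⟩
  · convert hp_deriv 0 using 1
    module
  · convert hp_deriv 1 using 1
    module
  · rw [hp, hB2, hA0, hC1]
    match_scalars <;> field_simp <;> ring
  · convert hp_deriv t using 1
    match_scalars <;> field_simp <;> ring
end

section
/- For every t ∈ ℝ ∖ {0,1}, the three lines AA0, BB2, and CC1 are concurrent: the point X(t) = (1/(t²−t+1))·((1−t)·A + t·B + t(t−1)·C) lies on the line through A and A0, on the line through B and B2, and on the line through C and C1. Moreover X(t) lies on the Steiner circumellipse of ABC, i.e., on the image of the unit circle under the unique affine map φ : ℝ² → ℝ² sending the vertices (1,0), (−1/2, √3/2), (−1/2, −√3/2) of the standard equilateral triangle inscribed in the unit circle to A, B, C respectively. -/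
/-- Three points are collinear when the third is an affine combination of the first two. -/
theorem collinear_triple_of_eq_lineMap {k V : Type*} [Field k] [AddCommGroup V] [Module k V]
    {P Q R : V} (r : k) (h : R = AffineMap.lineMap P Q r) : Collinear k {P, Q, R} := by
  rw [collinear_iff_of_mem (p₀ := P) (by simp)]
  refine ⟨Q - P, ?_⟩
  rintro p (rfl | rfl | rfl)
  · exact ⟨0, by simp⟩
  · exact ⟨1, by simp⟩
  · exact ⟨r, by rw [h, AffineMap.lineMap_apply]; rfl⟩

/-- An affine map between modules preserves combinations with weights of sum one. -/
theorem AffineMap.map_smul_add_smul_add_smul {k V W : Type*} [CommRing k]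
    [AddCommGroup V] [Module k V] [AddCommGroup W] [Module k W] (φ : V →ᵃ[k] W)
    {a b c : k} (h : a + b + c = 1) (p q r : V) :
    φ (a • p + b • q + c • r) = a • φ p + b • φ q + c • φ r := by
  have hφ (x : V) : φ x = φ.linear x + φ 0 := congrFun φ.decomp x
  rw [hφ (a • p + b • q + c • r), hφ p, hφ q, hφ r]
  simp only [map_add, map_smul]
  obtain rfl : a = 1 - b - c := by linear_combination h
  module

/-!
STATEMENT 1: For every `t ∈ ℝ ∖ {0,1}`, the lines `AA0`, `BB2`, `CC1` are concurrent
in the point `X(t) = (1/(t²−t+1))·((1−t)·A + t·B + t(t−1)·C)`, and `X(t)` lies on the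
Steiner circumellipse of `ABC`, i.e. on the image of the unit circle under the unique
affine map sending `(1,0)`, `(−1/2,√3/2)`, `(−1/2,−√3/2)` to `A`, `B`, `C`.
-/

theorem exparabola_cevians_concurrent_on_steiner_circumellipse
    (c c1 c2 : ℝ) (hc : 0 < c) (hc2 : 0 < c2)
    (A B C : ℝ × ℝ) (hA : A = (0, 0)) (hB : B = (c, 0)) (hC : C = (c1, c2))
    (t : ℝ) (ht0 : t ≠ 0) (ht1 : t ≠ 1)
    (B2 A0 C1 X : ℝ × ℝ)
    (hB2 : B2 = (1 / (1 - t)) • (A - t • C))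
    (hA0 : A0 = (1 / t) • (B + (t - 1) • C))
    (hC1 : C1 = (1 - t) • A + t • B)
    (hX : X = (1 / (t ^ 2 - t + 1)) • ((1 - t) • A + t • B + (t * (t - 1)) • C)) :
    Collinear ℝ {A, A0, X} ∧ Collinear ℝ {B, B2, X} ∧ Collinear ℝ {C, C1, X} ∧
    ∀ φ : ℝ × ℝ →ᵃ[ℝ] ℝ × ℝ,
      φ (1, 0) = A → φ (-(1 / 2), Real.sqrt 3 / 2) = B →
      φ (-(1 / 2), -(Real.sqrt 3 / 2)) = C →
      X ∈ φ '' {q : ℝ × ℝ | q.1 ^ 2 + q.2 ^ 2 = 1} := by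
  have hs : t ^ 2 - t + 1 ≠ 0 := by nlinarith [sq_nonneg (t - 1), sq_nonneg t]
  have hs' : t * (t - 1) + 1 ≠ 0 := by convert hs using 1; ring
  have ht1' : 1 - t ≠ 0 := sub_ne_zero.mpr ht1.symm
  refine ⟨collinear_triple_of_eq_lineMap (t ^ 2 / (t ^ 2 - t + 1)) ?_,
    collinear_triple_of_eq_lineMap ((1 - t) ^ 2 / (t ^ 2 - t + 1)) ?_,
    collinear_triple_of_eq_lineMap (1 / (t ^ 2 - t + 1)) ?_, ?_⟩
  · rw [hX, hA0, AffineMap.lineMap_apply_module]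
    match_scalars <;> field_simp <;> ring
  · rw [hX, hB2, AffineMap.lineMap_apply_module]
    match_scalars <;> field_simp <;> ring
  · rw [hX, hC1, AffineMap.lineMap_apply_module]
    match_scalars <;> field_simp <;> ring
  · intro φ hφA hφB hφC
    refine ⟨((1 - t) / (t ^ 2 - t + 1)) • (1, 0)
      + (t / (t ^ 2 - t + 1)) • (-(1 / 2), Real.sqrt 3 / 2)
      + (t * (t - 1) / (t ^ 2 - t + 1)) • (-(1 / 2), -(Real.sqrt 3 / 2)), ?_, ?_⟩
    · have h3 : Real.sqrt 3 ^ 2 = 3 := Real.sq_sqrt (by norm_num)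
      simp only [Set.mem_ofPred_eq, Prod.fst_add, Prod.snd_add, Prod.smul_fst, Prod.smul_snd,
        smul_eq_mul]
      field_simp
      ring_nf
      rw [h3]
      ring
    · rw [φ.map_smul_add_smul_add_smul (by field_simp; ring), hφA, hφB, hφC, hX]
      module
end

section
/- For all real numbers a, b, c > 0, the cubic polynomial e(t) = c²t³ + (1/2)(a² − b² − 3c²)t² − (1/2)(3a² + b² − c²)t + a² has three real roots t0, t1, t2 satisfying the interlacing t0 < 0 < t1 < 1 < t2, and every real root of e is one of t0, t1, t2. -/
/-!
STATEMENT 4: For all `a, b, c > 0`, the cubic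
`e(t) = c²t³ + ½(a²−b²−3c²)t² − ½(3a²+b²−c²)t + a²`
has three real roots `t0 < 0 < t1 < 1 < t2`, and every real root of `e` is one of them.
-/

/-- A cubic with three distinct roots has no further root. -/
theorem eq_or_eq_or_eq_of_cubic_roots {K : Type*} [Field K] {p q r s x y z t : K} (hp : p ≠ 0)
    (hxy : x ≠ y) (hxz : x ≠ z) (hyz : y ≠ z)
    (hx : p * x ^ 3 + q * x ^ 2 + r * x + s = 0) (hy : p * y ^ 3 + q * y ^ 2 + r * y + s = 0)
    (hz : p * z ^ 3 + q * z ^ 2 + r * z + s = 0) (ht : p * t ^ 3 + q * t ^ 2 + r * t + s = 0) :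
    t = x ∨ t = y ∨ t = z := by
  by_contra! h
  have quad {u : K} (hu : p * u ^ 3 + q * u ^ 2 + r * u + s = 0) (h_ne : t ≠ u) :
      p * (t ^ 2 + t * u + u ^ 2) + q * (t + u) + r = 0 :=
    mul_left_cancel₀ (sub_ne_zero.2 h_ne) (by linear_combination ht - hu)
  have lin {u : K} (hu : p * u ^ 3 + q * u ^ 2 + r * u + s = 0) (h_ne : t ≠ u) (hxu : x ≠ u) :
      p * (t + x + u) + q = 0 :=
    mul_left_cancel₀ (sub_ne_zero.2 hxu) (by linear_combination quad hx h.1 - quad hu h_ne)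
  have key : p * (y - z) = 0 := by
    linear_combination lin hy h.2.1 hxy - lin hz h.2.2 hxz
  exact mul_ne_zero hp (sub_ne_zero.2 hyz) key

theorem max_exparabola_cubic_has_three_interlacing_roots
    (a b c : ℝ) (ha : 0 < a) (hb : 0 < b) (hc : 0 < c)
    (e : ℝ → ℝ)
    (he : ∀ t : ℝ, e t = c ^ 2 * t ^ 3 + (1 / 2) * (a ^ 2 - b ^ 2 - 3 * c ^ 2) * t ^ 2
      - (1 / 2) * (3 * a ^ 2 + b ^ 2 - c ^ 2) * t + a ^ 2) :
    ∃ t0 t1 t2 : ℝ,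
      t0 < 0 ∧ 0 < t1 ∧ t1 < 1 ∧ 1 < t2 ∧
      e t0 = 0 ∧ e t1 = 0 ∧ e t2 = 0 ∧
      ∀ t : ℝ, e t = 0 → t = t0 ∨ t = t1 ∨ t = t2 := by
  have e_eq (t : ℝ) : e t = (c ^ 2 * (t * (t - 1) * (2 * t - 1)) + a ^ 2 * ((t - 1) * (t - 2))
      - b ^ 2 * (t * (t + 1))) / 2 := by rw [he]; ring
  have hcont : Continuous e := by
    rw [funext he]
    fun_prop
  have e_zero : 0 < e 0 := by rw [he]; norm_num; positivity
  have e_one : e 1 < 0 := by rw [he]; nlinarith [pow_pos hb 2]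
  obtain ⟨S, hS, e_neg⟩ : ∃ S : ℝ, S < 0 ∧ e S < 0 := by
    have hu : 0 < a ^ 2 / c ^ 2 := by positivity
    have ha2 : a ^ 2 = c ^ 2 * (a ^ 2 / c ^ 2) := by field_simp
    set u := a ^ 2 / c ^ 2
    refine ⟨-(2 + u), by linarith, ?_⟩
    have h : e (-(2 + u)) = -(c ^ 2 * ((3 + u) * (u ^ 2 + 5 * u + 10))
        + b ^ 2 * ((2 + u) * (1 + u))) / 2 := by
      rw [e_eq, ha2]; ring
    rw [h, neg_div, neg_lt_zero]
    positivity
  obtain ⟨T, hT, e_pos⟩ : ∃ T : ℝ, 1 < T ∧ 0 < e T := by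
    have hv : 0 < b ^ 2 / c ^ 2 := by positivity
    have hb2 : b ^ 2 = c ^ 2 * (b ^ 2 / c ^ 2) := by field_simp
    set v := b ^ 2 / c ^ 2
    refine ⟨3 + v, by linarith, ?_⟩
    have h : e (3 + v) = (c ^ 2 * ((3 + v) * (v ^ 2 + 5 * v + 10))
        + a ^ 2 * ((2 + v) * (1 + v))) / 2 := by
      rw [e_eq, hb2]; ring
    rw [h]
    positivity
  obtain ⟨t0, ⟨-, h0⟩, e0⟩ := intermediate_value_Ioo hS.le hcont.continuousOn ⟨e_neg, e_zero⟩
  obtain ⟨t1, ⟨h1, h1'⟩, e1⟩ :=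
    intermediate_value_Ioo' zero_le_one hcont.continuousOn ⟨e_one, e_zero⟩
  obtain ⟨t2, ⟨h2, -⟩, e2⟩ := intermediate_value_Ioo hT.le hcont.continuousOn ⟨e_one, e_pos⟩
  refine ⟨t0, t1, t2, h0, h1, h1', h2, e0, e1, e2, fun t ht => ?_⟩
  have cubic {x : ℝ} (hx : e x = 0) : c ^ 2 * x ^ 3 + (1 / 2) * (a ^ 2 - b ^ 2 - 3 * c ^ 2) * x ^ 2
      + -((1 / 2) * (3 * a ^ 2 + b ^ 2 - c ^ 2)) * x + a ^ 2 = 0 := by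
    rw [← hx, he]; ring
  exact eq_or_eq_or_eq_of_cubic_roots (pow_ne_zero 2 hc.ne') (h0.trans h1).ne
    (by linarith : t0 < t2).ne (h1'.trans h2).ne (cubic e0) (cubic e1) (cubic e2) (cubic ht)
end

section
/- For every t ∈ ℝ, the function ϱ² : ℝ → ℝ, ϱ²(t) = 4c⁴c2⁴·t²(t−1)²/D(t)³, is differentiable at t with derivative (d/dt)ϱ²(t) = −8c⁴c2⁴·t(t−1)·e(t)/D(t)⁴, where e(t) = c²t³ − c(c+c1)t² + (−c² + 3c·c1 − 2c1² − 2c2²)t + (c² − 2c·c1 + c1² + c2²). In particular, for t ∈ ℝ ∖ {0,1}, the derivative of ϱ² vanishes at t if and only if e(t) = 0. -/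
/-!
STATEMENT 5: The squared parameter `ϱ²(t) = 4c⁴c2⁴·t²(t−1)²/D(t)³` of the exparabola is
differentiable everywhere with derivative `−8c⁴c2⁴·t(t−1)·e(t)/D(t)⁴`; in particular,
for `t ∉ {0,1}`, the derivative vanishes at `t` iff `e(t) = 0`.
-/

theorem deriv_of_squared_parameter
    (c c1 c2 : ℝ) (hc : 0 < c) (hc2 : 0 < c2)
    (D : ℝ → ℝ)
    (hD : ∀ t : ℝ, D t = c ^ 2 * t ^ 2 + 2 * c * (c1 - c) * t + c ^ 2 - 2 * c * c1
      + c1 ^ 2 + c2 ^ 2)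
    (e : ℝ → ℝ)
    (he : ∀ t : ℝ, e t = c ^ 2 * t ^ 3 - c * (c + c1) * t ^ 2
      + (-c ^ 2 + 3 * c * c1 - 2 * c1 ^ 2 - 2 * c2 ^ 2) * t
      + (c ^ 2 - 2 * c * c1 + c1 ^ 2 + c2 ^ 2))
    (ρsq : ℝ → ℝ)
    (hρsq : ∀ t : ℝ, ρsq t = 4 * c ^ 4 * c2 ^ 4 * t ^ 2 * (t - 1) ^ 2 / (D t) ^ 3) :
    (∀ t : ℝ, HasDerivAt ρsq (-8 * c ^ 4 * c2 ^ 4 * t * (t - 1) * e t / (D t) ^ 4) t) ∧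
    (∀ t : ℝ, t ≠ 0 → t ≠ 1 → (deriv ρsq t = 0 ↔ e t = 0)) := by
  have hDpos (t : ℝ) : 0 < D t := by
    have h : D t = (c * t + c1 - c) ^ 2 + c2 ^ 2 := by rw [hD]; ring
    rw [h]
    positivity
  have hderiv (t : ℝ) :
      HasDerivAt ρsq (-8 * c ^ 4 * c2 ^ 4 * t * (t - 1) * e t / (D t) ^ 4) t := by
    have hne : D t ≠ 0 := (hDpos t).ne'
    have hD' : HasDerivAt D (2 * c ^ 2 * t + 2 * c * (c1 - c)) t := by
      rw [funext hD]
      have h := (((((((hasDerivAt_id' t).pow 2).const_mul (c ^ 2)).add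
        ((hasDerivAt_id' t).const_mul (2 * c * (c1 - c)))).add_const (c ^ 2)).sub_const
        (2 * c * c1)).add_const (c1 ^ 2)).add_const (c2 ^ 2)
      refine h.congr_deriv ?_
      push_cast
      ring
    have hnum := (((hasDerivAt_id' t).pow 2).const_mul (4 * c ^ 4 * c2 ^ 4)).mul
      (((hasDerivAt_id' t).sub_const 1).pow 2)
    have hquot := hnum.div (hD'.pow 3) (pow_ne_zero 3 hne)
    rw [funext hρsq]
    refine hquot.congr_deriv ?_
    have key : -2 * e t =
        2 * (2 * t - 1) * D t - 3 * t * (t - 1) * (2 * c ^ 2 * t + 2 * c * (c1 - c)) := by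
      rw [hD, he]; ring
    simp only [Pi.mul_apply, Pi.pow_apply]
    rw [div_eq_div_iff (pow_ne_zero 2 (pow_ne_zero 3 hne)) (pow_ne_zero 4 hne)]
    push_cast
    linear_combination (-4 * c ^ 4 * c2 ^ 4 * t * (t - 1) * D t ^ 6) * key
  refine ⟨hderiv, fun t ht0 ht1 => ?_⟩
  rw [(hderiv t).deriv]
  simp [hc.ne', hc2.ne', ht0, sub_ne_zero.mpr ht1, (hDpos t).ne']
end

section
/- Let P0 = (x0,y0), P1 = (x1,y1), P2 = (x2,y2) be affinely independent points of ℝ² and let P(u) = (1−u)²·P0 + 2(1−u)u·P1 + u²·P2. Define ϱ² = 4·(x0y1 − x0y2 − x1y0 + x1y2 + x2y0 − x2y1)⁴ / N³, where N = ‖P0 − 2P1 + P2‖² > 0. Then ϱ² > 0 and, with ϱ its positive square root, there exists an isometry φ of ℝ² such that φ maps the image of P onto the standard parabola {(x, x²/(2ϱ)) : x ∈ ℝ}; i.e., ϱ is the parameter (vertex curvature radius) of the Bézier parabola. -/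
/-- The orientation-preserving rigid motion of the plane whose linear part sends the unit vector
`(p, q)` to `(0, 1)` and `(q, -p)` to `(1, 0)`, followed by the translation by `(h, k)`. -/
noncomputable def planeMotion (p q h k : ℝ) (hpq : p ^ 2 + q ^ 2 = 1) :
    EuclideanSpace ℝ (Fin 2) ≃ᵢ EuclideanSpace ℝ (Fin 2) :=
  IsometryEquiv.mk' (fun z => !₂[q * z 0 - p * z 1 + h, p * z 0 + q * z 1 + k])
    (fun w => !₂[q * (w 0 - h) + p * (w 1 - k), -p * (w 0 - h) + q * (w 1 - k)])
    (fun w => by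
      ext i
      fin_cases i
      · simp
        linear_combination (w 0 - h) * hpq
      · simp
        linear_combination (w 1 - k) * hpq)
    (Isometry.of_dist_eq fun z w => by
      simp only [EuclideanSpace.dist_eq, Fin.sum_univ_two, Real.dist_eq, sq_abs]
      congr 1
      simp
      linear_combination ((z 0 - w 0) ^ 2 + (z 1 - w 1) ^ 2) * hpq)

theorem planeMotion_apply_zero (p q h k : ℝ) (hpq : p ^ 2 + q ^ 2 = 1)
    (z : EuclideanSpace ℝ (Fin 2)) :
    planeMotion p q h k hpq z 0 = q * z 0 - p * z 1 + h := rfl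

theorem planeMotion_apply_one (p q h k : ℝ) (hpq : p ^ 2 + q ^ 2 = 1)
    (z : EuclideanSpace ℝ (Fin 2)) :
    planeMotion p q h k hpq z 1 = p * z 0 + q * z 1 + k := rfl

/-- The signed area determinant of an affinely independent triple in the plane is nonzero. -/
theorem AffineIndependent.plane_det_ne_zero {A B C : EuclideanSpace ℝ (Fin 2)}
    (hABC : AffineIndependent ℝ ![A, B, C]) :
    (B 0 - A 0) * (C 1 - A 1) - (B 1 - A 1) * (C 0 - A 0) ≠ 0 := by
  intro hdet
  rw [affineIndependent_iff_linearIndependent_vsub ℝ _ (0 : Fin 3),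
    ← linearIndependent_equiv (finSuccAboveEquiv (0 : Fin 3))] at hABC
  have hpair : LinearIndependent ℝ ![B - A, C - A] := by
    have hvec : (fun i : {i : Fin 3 // i ≠ 0} => ![A, B, C] i -ᵥ ![A, B, C] 0) ∘
        finSuccAboveEquiv (0 : Fin 3) = ![B - A, C - A] := by
      ext1 i
      fin_cases i <;> rfl
    rwa [hvec] at hABC
  rw [LinearIndependent.pair_iff] at hpair
  have h₁ := hpair (C 1 - A 1) (-(B 1 - A 1)) (by
    ext i
    fin_cases i
    · simp
      linear_combination hdet
    · simp
      ring)
  have h₀ := hpair (C 0 - A 0) (-(B 0 - A 0)) (by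
    ext i
    fin_cases i
    · simp
      ring
    · simp
      linear_combination -hdet)
  have hC : C - A = 0 := by
    ext i
    fin_cases i
    · exact h₀.1
    · exact h₁.1
  have := hpair 0 1 (by simp [hC])
  exact one_ne_zero this.2

theorem parameter_of_bezier_parabola
    (x0 y0 x1 y1 x2 y2 : ℝ)
    (P0 P1 P2 : EuclideanSpace ℝ (Fin 2))
    (hP0 : P0 = ![x0, y0]) (hP1 : P1 = ![x1, y1]) (hP2 : P2 = ![x2, y2])
    (hindep : AffineIndependent ℝ ![P0, P1, P2])
    (P : ℝ → EuclideanSpace ℝ (Fin 2))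
    (hP : ∀ u : ℝ, P u = (1 - u) ^ 2 • P0 + (2 * (1 - u) * u) • P1 + u ^ 2 • P2)
    (N ρsq : ℝ)
    (hN : N = ‖P0 - 2 • P1 + P2‖ ^ 2)
    (hρsq : ρsq = 4 * (x0 * y1 - x0 * y2 - x1 * y0 + x1 * y2 + x2 * y0 - x2 * y1) ^ 4
      / N ^ 3) :
    0 < ρsq ∧
    ∃ φ : EuclideanSpace ℝ (Fin 2) ≃ᵢ EuclideanSpace ℝ (Fin 2),
      φ '' (Set.range P) =
        {q : EuclideanSpace ℝ (Fin 2) | q 1 = (q 0) ^ 2 / (2 * Real.sqrt ρsq)} := by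
  have hx0 : P0 0 = x0 := by simp [hP0]
  have hy0 : P0 1 = y0 := by simp [hP0]
  have hx1 : P1 0 = x1 := by simp [hP1]
  have hy1 : P1 1 = y1 := by simp [hP1]
  have hx2 : P2 0 = x2 := by simp [hP2]
  have hy2 : P2 1 = y2 := by simp [hP2]
  have hdet := hindep.plane_det_ne_zero
  rw [hx0, hy0, hx1, hy1, hx2, hy2] at hdet
  have hNsq : N = (x0 - 2 * x1 + x2) ^ 2 + (y0 - 2 * y1 + y2) ^ 2 := by
    rw [hN, EuclideanSpace.norm_sq_eq, Fin.sum_univ_two]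
    simp [hx0, hy0, hx1, hy1, hx2, hy2]
  have hNpos : 0 < N := by
    rcases (hNsq ▸ by positivity : 0 ≤ N).lt_or_eq with h | h
    · exact h
    · have ha : x0 - 2 * x1 + x2 = 0 := by nlinarith
      have hb : y0 - 2 * y1 + y2 = 0 := by nlinarith
      exact absurd (by linear_combination (x1 - x0) * hb - (y1 - y0) * ha) hdet
  obtain ⟨n, hn, hnN⟩ : ∃ n : ℝ, 0 < n ∧ n ^ 2 = N :=
    ⟨√N, Real.sqrt_pos.2 hNpos, Real.sq_sqrt hNpos.le⟩
  obtain ⟨p, hp⟩ : ∃ p, n * p = x0 - 2 * x1 + x2 := ⟨(x0 - 2 * x1 + x2) / n, by field_simp⟩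
  obtain ⟨q, hq⟩ : ∃ q, n * q = y0 - 2 * y1 + y2 := ⟨(y0 - 2 * y1 + y2) / n, by field_simp⟩
  have hpq : p ^ 2 + q ^ 2 = 1 := by
    rw [← hp, ← hq, ← hnN] at hNsq
    have : n ^ 2 ≠ 0 := by positivity
    exact mul_left_cancel₀ this (by linear_combination -hNsq)
  obtain ⟨d, hd⟩ : ∃ d, d = (x1 - x0) * q - (y1 - y0) * p := ⟨_, rfl⟩
  obtain ⟨e, he⟩ : ∃ e, e = (x1 - x0) * p + (y1 - y0) * q := ⟨_, rfl⟩
  have hD : x0 * y1 - x0 * y2 - x1 * y0 + x1 * y2 + x2 * y0 - x2 * y1 = n * d := by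
    rw [hd]
    linear_combination (y1 - y0) * hp - (x1 - x0) * hq
  have hd0 : d ≠ 0 := by
    rintro rfl
    exact hdet (by linear_combination hD)
  have hρ : ρsq = (2 * d ^ 2 / n) ^ 2 := by
    rw [hρsq, hD, ← hnN]
    field_simp
    ring
  have hsqrt : √ρsq = 2 * d ^ 2 / n := by
    rw [hρ, Real.sqrt_sq (by positivity)]
  refine ⟨by rw [hρ]; positivity, ?_⟩
  let φ := planeMotion p q (2 * d * e / n - (q * x0 - p * y0)) (e ^ 2 / n - (p * x0 + q * y0)) hpq
  have hφ0 : ∀ u, φ (P u) 0 = 2 * d * (u + e / n) := fun u => by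
    have : φ (P u) 0 = _ := planeMotion_apply_zero ..
    rw [this, hP]
    simp only [PiLp.add_apply, PiLp.smul_apply, smul_eq_mul, hx0, hy0, hx1, hy1, hx2, hy2]
    rw [show x2 = n * p - x0 + 2 * x1 by linear_combination -hp,
      show y2 = n * q - y0 + 2 * y1 by linear_combination -hq]
    linear_combination -2 * u * hd
  have hφ1 : ∀ u, φ (P u) 1 = n * (u + e / n) ^ 2 := fun u => by
    have : φ (P u) 1 = _ := planeMotion_apply_one ..
    rw [this, hP]
    simp only [PiLp.add_apply, PiLp.smul_apply, smul_eq_mul, hx0, hy0, hx1, hy1, hx2, hy2]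
    rw [show x2 = n * p - x0 + 2 * x1 by linear_combination -hp,
      show y2 = n * q - y0 + 2 * y1 by linear_combination -hq]
    have hsq : n * (u + e / n) ^ 2 = n * u ^ 2 + 2 * u * e + e ^ 2 / n := by
      field_simp
      ring
    rw [hsq]
    linear_combination n * u ^ 2 * hpq - 2 * u * he
  refine ⟨φ, ?_⟩
  rw [hsqrt, ← Set.range_comp]
  ext w
  constructor
  · rintro ⟨u, rfl⟩
    simp only [Function.comp_apply, Set.mem_ofPred_eq, hφ0, hφ1]
    field_simp
  · intro hw
    refine ⟨w 0 / (2 * d) - e / n, ?_⟩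
    ext i
    fin_cases i
    · refine (hφ0 _).trans ?_
      simp
      field_simp
    · refine (hφ1 _).trans (Eq.trans ?_ hw.symm)
      field_simp
      ring
end

section
/- Let t* ∈ ℝ ∖ {0,1} satisfy e(t*) = 0, where e(t) = c²t³ − c(c+c1)t² + (−c² + 3c·c1 − 2c1² − 2c2²)t + (c² − 2c·c1 + c1² + c2²). Then the function ϱ²(t) = 4c⁴c2⁴·t²(t−1)²/D(t)³ has a local maximum at t*. (Thus each exparabola of stationary parameter is a max-exparabola: its parameter is locally maximal.) -/
/-- At a root `t` of the cubic `e`, the product `t (t - 1) e'(t)` is a sum of squares. -/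
lemma mul_derivative_cubic_eq_of_root {c c1 c2 t : ℝ}
    (h : c ^ 2 * t ^ 3 - c * (c + c1) * t ^ 2
      + (-c ^ 2 + 3 * c * c1 - 2 * c1 ^ 2 - 2 * c2 ^ 2) * t
      + (c ^ 2 - 2 * c * c1 + c1 ^ 2 + c2 ^ 2) = 0) :
    t * (t - 1) * (3 * c ^ 2 * t ^ 2 - 2 * c * (c + c1) * t
      + (-c ^ 2 + 3 * c * c1 - 2 * c1 ^ 2 - 2 * c2 ^ 2))
      = ((c1 - c) ^ 2 + c2 ^ 2) * (t - 1) ^ 2 + (c1 ^ 2 + c2 ^ 2) * t ^ 2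
        + c ^ 2 * t ^ 2 * (t - 1) ^ 2 := by
  linear_combination (2 * t - 1) * h

theorem stationary_parameter_is_local_max
    (c c1 c2 : ℝ) (hc : 0 < c) (hc2 : 0 < c2)
    (D : ℝ → ℝ)
    (hD : ∀ t : ℝ, D t = c ^ 2 * t ^ 2 + 2 * c * (c1 - c) * t + c ^ 2 - 2 * c * c1
      + c1 ^ 2 + c2 ^ 2)
    (e : ℝ → ℝ)
    (he : ∀ t : ℝ, e t = c ^ 2 * t ^ 3 - c * (c + c1) * t ^ 2
      + (-c ^ 2 + 3 * c * c1 - 2 * c1 ^ 2 - 2 * c2 ^ 2) * t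
      + (c ^ 2 - 2 * c * c1 + c1 ^ 2 + c2 ^ 2))
    (ρsq : ℝ → ℝ)
    (hρsq : ∀ t : ℝ, ρsq t = 4 * c ^ 4 * c2 ^ 4 * t ^ 2 * (t - 1) ^ 2 / (D t) ^ 3)
    (tstar : ℝ) (ht0 : tstar ≠ 0) (ht1 : tstar ≠ 1) (hroot : e tstar = 0) :
    IsLocalMax ρsq tstar := by
  have hDpos : ∀ t, 0 < D t := fun t ↦ by
    have hsq : D t = (c * t + c1 - c) ^ 2 + c2 ^ 2 := by rw [hD]; ring
    rw [hsq]; positivity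
  have hDderiv : ∀ t, HasDerivAt D (2 * c ^ 2 * t + 2 * c * (c1 - c)) t := fun t ↦ by
    rw [funext hD]
    have h := ((((((hasDerivAt_id' t).pow 2).const_mul (c ^ 2)).add
      ((hasDerivAt_id' t).const_mul (2 * c * (c1 - c)))).add_const (c ^ 2)).sub_const
      (2 * c * c1)).add_const (c1 ^ 2) |>.add_const (c2 ^ 2)
    exact h.congr_deriv (by norm_num; ring)
  have hederiv : HasDerivAt e (3 * c ^ 2 * tstar ^ 2 - 2 * c * (c + c1) * tstar
      + (-c ^ 2 + 3 * c * c1 - 2 * c1 ^ 2 - 2 * c2 ^ 2)) tstar := by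
    rw [funext he]
    have h := (((((hasDerivAt_id' tstar).pow 3).const_mul (c ^ 2)).sub
      (((hasDerivAt_id' tstar).pow 2).const_mul (c * (c + c1)))).add
      ((hasDerivAt_id' tstar).const_mul
        (-c ^ 2 + 3 * c * c1 - 2 * c1 ^ 2 - 2 * c2 ^ 2))).add_const
      (c ^ 2 - 2 * c * c1 + c1 ^ 2 + c2 ^ 2)
    exact h.congr_deriv (by norm_num; ring)
  have hρderiv : ∀ t, HasDerivAt ρsq
      (-8 * c ^ 4 * c2 ^ 4 * (t * (t - 1)) / D t ^ 4 * e t) t := fun t ↦ by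
    rw [funext hρsq]
    have hne := (hDpos t).ne'
    have h := ((((hasDerivAt_id' t).pow 2).const_mul (4 * c ^ 4 * c2 ^ 4)).mul
      (((hasDerivAt_id' t).sub_const 1).pow 2)).div ((hDderiv t).pow 3) (pow_ne_zero 3 hne)
    have hcubic : e t = 3 * t * (t - 1) * (c ^ 2 * t + c * (c1 - c)) - (2 * t - 1) * D t := by
      rw [he, hD]; ring
    refine h.congr_deriv ?_
    rw [hcubic]
    simp only [Pi.pow_apply, Pi.mul_apply]
    field_simp
    norm_num
    ring
  have hcoeff : DifferentiableAt ℝ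
      (fun t ↦ -8 * c ^ 4 * c2 ^ 4 * (t * (t - 1)) / D t ^ 4) tstar :=
    DifferentiableAt.div (by fun_prop) ((hDderiv tstar).differentiableAt.pow 4)
      (pow_ne_zero 4 (hDpos tstar).ne')
  have hρderiv2 := hcoeff.hasDerivAt.mul hederiv
  refine isLocalMax_of_deriv_deriv_neg ?_ ?_ (hρderiv tstar).continuousAt
  · rw [funext fun t ↦ (hρderiv t).deriv]
    refine hρderiv2.deriv.trans_lt ?_
    rw [hroot, mul_zero, zero_add, div_mul_eq_mul_div, mul_assoc (-8 * c ^ 4 * c2 ^ 4),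
      mul_derivative_cubic_eq_of_root ((he tstar).symm.trans hroot)]
    have hsub : tstar - 1 ≠ 0 := sub_ne_zero.mpr ht1
    refine div_neg_of_neg_of_pos (mul_neg_of_neg_of_pos ?_ (by positivity))
      (pow_pos (hDpos tstar) 4)
    have : 0 < c ^ 4 * c2 ^ 4 := by positivity
    linarith
  · rw [(hρderiv tstar).deriv, hroot, mul_zero]
end

section
/- Let a, b, c > 0 and let x0, x1, x2 be real numbers with x0 + x1 + x2 = 1 satisfying (x0+x1)(x1+x2) > 0, (x0+x2)(x1+x2) > 0, and (x0+x1)(x0+x2) > 0. Then the cubic f(t) = c²(x0+x1)t³ + ((a²−b²)x2 − (2x0+x1)c²)t² + ((c²−b²)x0 − (2x2+x1)a²)t + a²(x1+x2) has three real roots t0, t1, t2 with t0 < 0 < t1 < 1 < t2. (These parametrize the three exparabolas whose axes pass through the point with normalized barycentric coordinates (x0,x1,x2), one opposite to each vertex.) -/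
/-!
STATEMENT 8: For `a, b, c > 0` and normalized barycentric coordinates `(x0, x1, x2)`
satisfying the three positivity conditions, the cubic `f` has three real roots
`t0 < 0 < t1 < 1 < t2` (parametrizing the three exparabolas with axes through the
corresponding point).
-/

/-- A real cubic with positive leading coefficient is positive at some `M > 1` and negative
at `-M`. -/
theorem exists_one_lt_cubic_pos_and_cubic_neg {p : ℝ} (hp : 0 < p) (q r s : ℝ) :
    ∃ M : ℝ, 1 < M ∧ 0 < p * M ^ 3 + q * M ^ 2 + r * M + s ∧
      p * (-M) ^ 3 + q * (-M) ^ 2 + r * (-M) + s < 0 := by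
  obtain ⟨M, hM⟩ : ∃ M : ℝ, p * M = 2 * p + |q| + |r| + |s| :=
    ⟨(2 * p + |q| + |r| + |s|) / p, by field_simp⟩
  have hM1 : 1 < M := by
    by_contra! h
    nlinarith [abs_nonneg q, abs_nonneg r, abs_nonneg s]
  have hM2 : M ≤ M ^ 2 := by nlinarith
  have hcube : p * M ^ 3 = (2 * p + |q| + |r| + |s|) * M ^ 2 := by rw [← hM]; ring
  have hlead : 0 < p * M ^ 2 := by positivity
  have hr : |r| * M ≤ |r| * M ^ 2 := by gcongr
  have hs : |s| ≤ |s| * M ^ 2 := le_mul_of_one_le_right (abs_nonneg s) (by linarith)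
  have hq_upper : q * M ^ 2 ≤ |q| * M ^ 2 := by gcongr; exact le_abs_self q
  have hq_lower : -|q| * M ^ 2 ≤ q * M ^ 2 := by gcongr; exact neg_abs_le q
  have hr_lower : -|r| * M ≤ r * M := by gcongr; exact neg_abs_le r
  have hs_upper := le_abs_self s
  have hs_lower := neg_abs_le s
  refine ⟨M, hM1, by linarith, ?_⟩
  have hneg : p * (-M) ^ 3 + q * (-M) ^ 2 + r * (-M) + s
      = -(p * M ^ 3) + q * M ^ 2 - r * M + s := by ring
  linarith

theorem axis_cubic_has_three_interlacing_roots
    (a b c : ℝ) (ha : 0 < a) (hb : 0 < b) (hc : 0 < c)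
    (x0 x1 x2 : ℝ) (hsum : x0 + x1 + x2 = 1)
    (h01 : (x0 + x1) * (x1 + x2) > 0)
    (h02 : (x0 + x2) * (x1 + x2) > 0)
    (h12 : (x0 + x1) * (x0 + x2) > 0)
    (f : ℝ → ℝ)
    (hf : ∀ t : ℝ, f t = c ^ 2 * (x0 + x1) * t ^ 3
      + ((a ^ 2 - b ^ 2) * x2 - (2 * x0 + x1) * c ^ 2) * t ^ 2
      + ((c ^ 2 - b ^ 2) * x0 - (2 * x2 + x1) * a ^ 2) * t
      + a ^ 2 * (x1 + x2)) :
    ∃ t0 t1 t2 : ℝ,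
      t0 < 0 ∧ 0 < t1 ∧ t1 < 1 ∧ 1 < t2 ∧
      f t0 = 0 ∧ f t1 = 0 ∧ f t2 = 0 := by
  have p01 : 0 < x0 + x1 := by
    by_contra! h
    nlinarith
  have p02 : 0 < x0 + x2 := pos_of_mul_pos_right h12 p01.le
  have p12 : 0 < x1 + x2 := pos_of_mul_pos_right h01 p01.le
  have hf0 : 0 < f 0 := by
    have : f 0 = a ^ 2 * (x1 + x2) := by rw [hf]; ring
    rw [this]; positivity
  have hf1 : f 1 < 0 := by
    have : f 1 = -(b ^ 2 * (x0 + x2)) := by rw [hf]; ring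
    rw [this, neg_lt_zero]; positivity
  have hcont : Continuous f := by
    rw [funext hf]; fun_prop
  have hlead : 0 < c ^ 2 * (x0 + x1) := by positivity
  obtain ⟨M, hM, hpos, hneg⟩ := exists_one_lt_cubic_pos_and_cubic_neg hlead
    ((a ^ 2 - b ^ 2) * x2 - (2 * x0 + x1) * c ^ 2)
    ((c ^ 2 - b ^ 2) * x0 - (2 * x2 + x1) * a ^ 2) (a ^ 2 * (x1 + x2))
  rw [← hf] at hpos hneg
  obtain ⟨t0, ht0, h0⟩ := intermediate_value_Ioo (by linarith : -M ≤ 0)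
    hcont.continuousOn ⟨hneg, hf0⟩
  obtain ⟨t1, ht1, h1⟩ := intermediate_value_Ioo' zero_le_one hcont.continuousOn ⟨hf1, hf0⟩
  obtain ⟨t2, ht2, h2⟩ := intermediate_value_Ioo hM.le hcont.continuousOn ⟨hf1, hpos⟩
  exact ⟨t0, t1, t2, ht0.2, ht1.1, ht1.2, ht2.1, h0, h1, h2⟩
end

section
/- Let a, b, c > 0, let x0, x1, x2 be real numbers with x0 + x1 + x2 = 1 and x0 + x1 ≠ 0, and let u, v, w be real numbers satisfying the Vieta relations u·v·w = −a²(x1+x2)/(c²(x0+x1)), u·v + v·w + w·u = −(a²(x1+2x2) + (b²−c²)x0)/(c²(x0+x1)), and u + v + w = (c²(2x0+x1) + (b²−a²)x2)/(c²(x0+x1)). Then h(u,v,w) = 0, where h(u,v,w) = c²((a²+b²)c² − (a²−b²)²)·uvw + a²c²(a²−b²−c²)·(uv+vw+wu) − a²c²(a²+b²−c²)·(u+v+w) + a²((b²+c²)a² − (b²−c²)²). -/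
/-!
STATEMENT 13: If `u, v, w` satisfy the Vieta relations for the cubic `f` (axes through
the point with normalized barycentric coordinates `(x0,x1,x2)`), then the orthocenter
condition `h(u,v,w) = 0` holds.
-/

theorem orthocenter_condition_from_vieta
    (a b c : ℝ) (ha : 0 < a) (hb : 0 < b) (hc : 0 < c)
    (x0 x1 x2 : ℝ) (hsum : x0 + x1 + x2 = 1) (hx01 : x0 + x1 ≠ 0)
    (u v w : ℝ)
    (hprod : u * v * w = -(a ^ 2 * (x1 + x2)) / (c ^ 2 * (x0 + x1)))
    (hpair : u * v + v * w + w * u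
      = -(a ^ 2 * (x1 + 2 * x2) + (b ^ 2 - c ^ 2) * x0) / (c ^ 2 * (x0 + x1)))
    (hsum3 : u + v + w
      = (c ^ 2 * (2 * x0 + x1) + (b ^ 2 - a ^ 2) * x2) / (c ^ 2 * (x0 + x1))) :
    c ^ 2 * ((a ^ 2 + b ^ 2) * c ^ 2 - (a ^ 2 - b ^ 2) ^ 2) * (u * v * w)
      + a ^ 2 * c ^ 2 * (a ^ 2 - b ^ 2 - c ^ 2) * (u * v + v * w + w * u)
      - a ^ 2 * c ^ 2 * (a ^ 2 + b ^ 2 - c ^ 2) * (u + v + w)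
      + a ^ 2 * ((b ^ 2 + c ^ 2) * a ^ 2 - (b ^ 2 - c ^ 2) ^ 2) = 0 := by
  rw [hprod, hpair, hsum3]
  field_simp
  ring
end

section
/- Let t0, t1, t2 ∈ ℝ ∖ {0,1} be pairwise distinct. Then the three points X(t_i) = (1/(t_i² − t_i + 1))·((1−t_i)·A + t_i·B + t_i(t_i−1)·C), i = 0,1,2, are pairwise distinct, and each X(t_i) lies on the Steiner circumellipse of ABC, i.e., in the image of the unit circle under the unique affine map φ : ℝ² → ℝ² sending the vertices (1,0), (−1/2, √3/2), (−1/2, −√3/2) of the standard equilateral triangle inscribed in the unit circle to A, B, C respectively. (Thus the three concurrency points arising from three exparabolas form a triangle inscribed in the Steiner circumellipse.) -/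
theorem AffineMap.map_barycentric {E F : Type*} [AddCommGroup E] [Module ℝ E] [AddCommGroup F]
    [Module ℝ F] (φ : E →ᵃ[ℝ] F) (P Q R : E) {u v w : ℝ} (h : u + v + w = 1) :
    φ (u • P + v • Q + w • R) = u • φ P + v • φ Q + w • φ R := by
  obtain rfl : u = 1 - v - w := by linarith
  have hφ (p : E) : φ p = φ.linear p + φ 0 := congrFun φ.decomp p
  rw [hφ P, hφ Q, hφ R, hφ]
  simp only [map_add, map_smul]
  module

theorem mul_sub_one_add_one_pos (t : ℝ) : 0 < t * (t - 1) + 1 := by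
  nlinarith [sq_nonneg (t - 1 / 2)]

/-- The barycentric weights `(1 - t : t : t (t - 1))` determine `t`. -/
theorem concurrency_point_injective {c c1 c2 : ℝ} (hc : 0 < c) (hc2 : 0 < c2) :
    Function.Injective fun t : ℝ => (1 / (t ^ 2 - t + 1)) •
      ((1 - t) • ((0, 0) : ℝ × ℝ) + t • (c, 0) + (t * (t - 1)) • (c1, c2)) := by
  intro s t h
  have hs := mul_sub_one_add_one_pos s
  have ht := mul_sub_one_add_one_pos t
  obtain ⟨h1, h2⟩ := Prod.ext_iff.mp h
  simp only [Prod.fst_add, Prod.snd_add, Prod.smul_fst, Prod.smul_snd, smul_eq_mul] at h1 h2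
  field_simp at h1 h2
  have hmul : s * (s - 1) = t * (t - 1) := by
    apply mul_left_cancel₀ hc2.ne'
    linear_combination h2
  apply mul_left_cancel₀ (mul_pos hc ht).ne'
  linear_combination h1 + (c * t - c1) * hmul

theorem concurrency_point_mem_image_unit_circle (φ : ℝ × ℝ →ᵃ[ℝ] ℝ × ℝ) (t : ℝ) :
    (1 / (t ^ 2 - t + 1)) • ((1 - t) • φ (1, 0) + t • φ (-(1 / 2), Real.sqrt 3 / 2) +
      (t * (t - 1)) • φ (-(1 / 2), -(Real.sqrt 3 / 2))) ∈
      φ '' {q : ℝ × ℝ | q.1 ^ 2 + q.2 ^ 2 = 1} := by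
  have ht := mul_sub_one_add_one_pos t
  have hsum : (1 - t) / (t ^ 2 - t + 1) + t / (t ^ 2 - t + 1) +
      t * (t - 1) / (t ^ 2 - t + 1) = 1 := by
    field_simp
    ring
  refine ⟨_, ?_, (φ.map_barycentric (1, 0) (-(1 / 2), Real.sqrt 3 / 2)
    (-(1 / 2), -(Real.sqrt 3 / 2)) hsum).trans (by module)⟩
  have h3 : Real.sqrt 3 ^ 2 = 3 := Real.sq_sqrt (by norm_num)
  simp only [Set.mem_ofPred_eq, Prod.fst_add, Prod.snd_add, Prod.smul_fst, Prod.smul_snd,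
    smul_eq_mul]
  field_simp
  linear_combination (t - t * (t - 1)) ^ 2 * h3

/-!
STATEMENT 18: For pairwise distinct `t0, t1, t2 ∈ ℝ ∖ {0,1}`, the three concurrency
points `X(t_i) = (1/(t_i²−t_i+1))·((1−t_i)·A + t_i·B + t_i(t_i−1)·C)` are pairwise
distinct and all lie on the Steiner circumellipse of `ABC` (the image of the unit
circle under the unique affine map sending `(1,0)`, `(−1/2,√3/2)`, `(−1/2,−√3/2)` to
`A`, `B`, `C`).
-/

theorem three_concurrency_points_on_steiner_circumellipse
    (c c1 c2 : ℝ) (hc : 0 < c) (hc2 : 0 < c2)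
    (A B C : ℝ × ℝ) (hA : A = (0, 0)) (hB : B = (c, 0)) (hC : C = (c1, c2))
    (X : ℝ → ℝ × ℝ)
    (hX : ∀ t : ℝ, X t = (1 / (t ^ 2 - t + 1)) •
      ((1 - t) • A + t • B + (t * (t - 1)) • C))
    (t0 t1 t2 : ℝ)
    (h00 : t0 ≠ 0) (h01 : t0 ≠ 1) (h10 : t1 ≠ 0) (h11 : t1 ≠ 1) (h20 : t2 ≠ 0) (h21 : t2 ≠ 1)
    (hne01 : t0 ≠ t1) (hne12 : t1 ≠ t2) (hne02 : t0 ≠ t2) :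
    (X t0 ≠ X t1 ∧ X t1 ≠ X t2 ∧ X t0 ≠ X t2) ∧
    ∀ φ : ℝ × ℝ →ᵃ[ℝ] ℝ × ℝ,
      φ (1, 0) = A → φ (-(1 / 2), Real.sqrt 3 / 2) = B →
      φ (-(1 / 2), -(Real.sqrt 3 / 2)) = C →
      (X t0 ∈ φ '' {q : ℝ × ℝ | q.1 ^ 2 + q.2 ^ 2 = 1} ∧
       X t1 ∈ φ '' {q : ℝ × ℝ | q.1 ^ 2 + q.2 ^ 2 = 1} ∧
       X t2 ∈ φ '' {q : ℝ × ℝ | q.1 ^ 2 + q.2 ^ 2 = 1}) := by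
  subst hA hB hC
  have hinj : Function.Injective X := by
    rw [funext hX]
    exact concurrency_point_injective hc hc2
  refine ⟨⟨hinj.ne hne01, hinj.ne hne12, hinj.ne hne02⟩, fun φ hA hB hC => ?_⟩
  have hmem (t : ℝ) : X t ∈ φ '' {q : ℝ × ℝ | q.1 ^ 2 + q.2 ^ 2 = 1} := by
    rw [hX, ← hA, ← hB, ← hC]
    exact concurrency_point_mem_image_unit_circle φ t
  exact ⟨hmem t0, hmem t1, hmem t2⟩
end

section
/- Let P0, P1, P2 be affinely independent points of ℝ² and let P(u) = (1−u)²·P0 + 2(1−u)u·P1 + u²·P2 be the Bézier parabola they define. Then there is exactly one affine line ℓ ⊆ ℝ² such that the reflection across ℓ maps the image of P onto itself (the axis of the parabola), and the direction of ℓ is spanned by the vector P0 − 2·P1 + P2. -/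
/-!
STATEMENT 19: A Bézier parabola with affinely independent control points `P0, P1, P2`
has exactly one symmetry axis (an affine line `ℓ` such that the reflection across `ℓ`
maps the image of the parabola onto itself), and the direction of this axis is spanned
by the vector `P0 − 2·P1 + P2`.

A line `ℓ` is a symmetry axis of a set `S` iff `ℓ` is an affine line (one-dimensional
direction) and there is an isometry of the plane whose fixed-point set is exactly `ℓ`
(i.e. the reflection across `ℓ`) mapping `S` onto itself.
-/

/-- `ℓ` is an affine line and the reflection across `ℓ` (the unique isometry of the
plane whose fixed-point set is exactly `ℓ`) maps `S` onto itself. -/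
def IsSymmetryAxis (S : Set (EuclideanSpace ℝ (Fin 2)))
    (ℓ : AffineSubspace ℝ (EuclideanSpace ℝ (Fin 2))) : Prop :=
  Module.finrank ℝ ℓ.direction = 1 ∧
  ∃ φ : EuclideanSpace ℝ (Fin 2) → EuclideanSpace ℝ (Fin 2),
    Isometry φ ∧ (∀ x, φ x = x ↔ x ∈ ℓ) ∧ φ '' S = S

open EuclideanGeometry in
/-- In a Euclidean plane, an isometry whose fixed points form a line is the reflection across it. -/
theorem eq_reflection_of_isometry_of_fixed_iff {V : Type*} [NormedAddCommGroup V]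
    [InnerProductSpace ℝ V] [FiniteDimensional ℝ V] (hV : Module.finrank ℝ V = 2)
    (ℓ : AffineSubspace ℝ V) [Nonempty ℓ] (hℓ : Module.finrank ℝ ℓ.direction = 1)
    {φ : V → V} (hφ : Isometry φ) (hfix : ∀ x, φ x = x ↔ x ∈ ℓ) (x : V) :
    φ x = reflection ℓ x := by
  by_cases hx : x ∈ ℓ
  · rw [(hfix x).2 hx, (reflection_eq_self_iff x).2 hx]
  obtain ⟨p, hp⟩ := (inferInstance : Nonempty ℓ)
  obtain ⟨d, hd, hd0⟩ : ∃ d ∈ ℓ.direction, d ≠ 0 := by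
    refine Submodule.exists_mem_ne_zero_of_ne_bot fun h => ?_
    rw [h, finrank_bot] at hℓ
    exact zero_ne_one hℓ
  have hq : d + p ∈ ℓ := AffineSubspace.vadd_mem_of_mem_direction hd hp
  have hdist : ∀ y ∈ ℓ, dist (reflection ℓ x) y = dist x y ∧ dist (φ x) y = dist x y := by
    intro y hy
    refine ⟨?_, ?_⟩
    · rw [dist_comm, dist_reflection_eq_of_mem ℓ hy, dist_comm]
    · nth_rw 1 [← (hfix y).2 hy]
      exact hφ.dist_eq x y
  have hne : x ≠ reflection ℓ x := fun h => hx ((reflection_eq_self_iff x).1 h.symm)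
  refine (eq_of_dist_eq_of_dist_eq_of_finrank_eq_two hV (c₁ := p) (c₂ := d + p)
    (by simpa using hd0) hne rfl (hdist p hp).1 (hdist p hp).2 rfl (hdist _ hq).1
    (hdist _ hq).2).resolve_left fun h => hx ((hfix x).1 h)

/-- In a Euclidean plane, vectors orthogonal to `e` are multiples of any nonzero vector
orthogonal to `e`. -/
theorem exists_smul_eq_of_inner_eq_zero {V : Type*} [NormedAddCommGroup V]
    [InnerProductSpace ℝ V] (hV : Module.finrank ℝ V = 2) {e a v : V}
    (he : e ≠ 0) (ha : a ≠ 0) (hea : inner ℝ e a = 0) (hev : inner ℝ e v = 0) :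
    ∃ c : ℝ, c • a = v := by
  have : Fact (Module.finrank ℝ V = 1 + 1) := ⟨hV⟩
  obtain ⟨c, hc⟩ := exists_smul_eq_of_finrank_eq_one
    (Submodule.finrank_orthogonal_span_singleton (𝕜 := ℝ) he)
    (x := ⟨a, Submodule.mem_orthogonal_singleton_iff_inner_right.2 hea⟩)
    (fun h => ha (congrArg Subtype.val h))
    ⟨v, Submodule.mem_orthogonal_singleton_iff_inner_right.2 hev⟩
  exact ⟨c, congrArg Subtype.val hc⟩

/-- A parabola admits a parametrization whose velocity at the base point (its vertex) is
orthogonal to its acceleration. -/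
theorem exists_vertex_parametrization {V : Type*} [NormedAddCommGroup V] [InnerProductSpace ℝ V]
    {P0 P1 P2 : V} (hindep : AffineIndependent ℝ ![P0, P1, P2]) :
    P0 - 2 • P1 + P2 ≠ 0 ∧ ∃ Q e : V, e ≠ 0 ∧ inner ℝ e (P0 - 2 • P1 + P2) = 0 ∧
      Set.range (fun u : ℝ => (1 - u) ^ 2 • P0 + (2 * (1 - u) * u) • P1 + u ^ 2 • P2) =
        Set.range fun t : ℝ => Q + t • e + t ^ 2 • (P0 - 2 • P1 + P2) := by
  have hlin : ∀ s t : ℝ, s • (P1 - P0) + t • (P2 - P0) = 0 → s = 0 ∧ t = 0 := by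
    rw [affineIndependent_iff_linearIndependent_vsub ℝ _ 0] at hindep
    have h := hindep.comp (![⟨1, by decide⟩, ⟨2, by decide⟩] : Fin 2 → {x : Fin 3 // x ≠ 0})
      (by decide)
    exact fun s t hst => LinearIndependent.pair_iff.1
      (by convert h using 1; ext i : 1; fin_cases i <;> rfl) s t hst
  have ha : P0 - 2 • P1 + P2 ≠ 0 := by
    intro h
    have := hlin (-2) 1 (by rw [← h]; module)
    norm_num at this
  refine ⟨ha, ?_⟩
  set a := P0 - 2 • P1 + P2 with hadef
  set c : ℝ := -(inner ℝ (P1 - P0) a / inner ℝ a a) with hc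
  have haa : inner ℝ a a ≠ (0 : ℝ) := inner_self_ne_zero.2 ha
  refine ⟨P0 + (2 * c) • (P1 - P0) + c ^ 2 • a, (2 : ℝ) • (P1 - P0 + c • a), ?_, ?_, ?_⟩
  · intro h
    have h' : (1 - 2 * c) • (P1 - P0) + c • (P2 - P0) = 0 := by
      have h2 : P1 - P0 + c • a = 0 := (smul_eq_zero.1 h).resolve_left two_ne_zero
      rw [← h2, hadef]
      module
    obtain ⟨h1, h2⟩ := hlin _ _ h'
    norm_num [h2] at h1
  · rw [inner_smul_left, inner_add_left, inner_smul_left, hc]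
    simp only [conj_trivial]
    field_simp
    ring
  · refine Set.Subset.antisymm ?_ ?_
    · rintro _ ⟨u, rfl⟩
      refine ⟨u - c, ?_⟩
      simp only [hadef]
      module
    · rintro _ ⟨t, rfl⟩
      refine ⟨t + c, ?_⟩
      simp only [hadef]
      module

/-- The parabola `Q + t e + t² a` with vertex `Q` is symmetric about the line through `Q` in the
direction of `a`. -/
theorem isSymmetryAxis_mk'_span {a e Q : EuclideanSpace ℝ (Fin 2)} (ha : a ≠ 0)
    (hea : inner ℝ e a = 0) :
    IsSymmetryAxis (Set.range fun t : ℝ => Q + t • e + t ^ 2 • a)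
      (AffineSubspace.mk' Q (Submodule.span ℝ {a})) := by
  set ℓ := AffineSubspace.mk' Q (Submodule.span ℝ {a}) with hℓ
  have hQ : Q ∈ ℓ := AffineSubspace.self_mem_mk' _ _
  have : Nonempty ℓ := ⟨⟨Q, hQ⟩⟩
  have hdir : ℓ.direction = Submodule.span ℝ {a} := AffineSubspace.direction_mk' _ _
  refine ⟨by rw [hdir, finrank_span_singleton ha], EuclideanGeometry.reflection ℓ,
    (EuclideanGeometry.reflection ℓ).isometry, EuclideanGeometry.reflection_eq_self_iff, ?_⟩
  have key : ∀ t : ℝ, EuclideanGeometry.reflection ℓ (Q + t • e + t ^ 2 • a) =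
      Q + (-t) • e + (-t) ^ 2 • a := by
    intro t
    have hQa : t ^ 2 • a + Q ∈ ℓ := AffineSubspace.vadd_mem_of_mem_direction
      (by rw [hdir]; exact Submodule.smul_mem _ _ (Submodule.mem_span_singleton_self a)) hQ
    have hte : t • e ∈ ℓ.directionᗮ := by
      rw [hdir]
      refine Submodule.smul_mem _ _ (Submodule.mem_orthogonal_singleton_iff_inner_left.2 hea)
    have := EuclideanGeometry.reflection_orthogonal_vadd hQa hte
    simp only [vadd_eq_add] at this
    rw [show Q + t • e + t ^ 2 • a = t • e + (t ^ 2 • a + Q) by abel, this]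
    module
  refine Set.Subset.antisymm ?_ ?_
  · rintro _ ⟨_, ⟨t, rfl⟩, rfl⟩
    exact ⟨-t, (key t).symm⟩
  · rintro _ ⟨t, rfl⟩
    exact ⟨_, ⟨-t, rfl⟩, by simpa using key (-t)⟩

/-- If a quadratic polynomial is pointwise the square of another one up to scaling, the inner one
has no quadratic term. -/
theorem quadratic_coeffs_of_eq_sq {p0 p1 p2 q0 q1 q2 k m : ℝ} (hm : m ≠ 0)
    (h : ∀ t : ℝ, k * (q0 + t * q1 + t ^ 2 * q2) = m * (p0 + t * p1 + t ^ 2 * p2) ^ 2) :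
    p2 = 0 ∧ k * q2 = m * p1 ^ 2 ∧ k * q1 = m * (2 * p0 * p1) := by
  have h0 := h 0
  have h1 := h 1
  have h2 := h (-1)
  have h3 := h 2
  have h4 := h (-2)
  have hp2 : p2 = 0 := by
    have : m * p2 ^ 2 = 0 := by linear_combination (-h3 - h4 + 4 * h1 + 4 * h2 - 6 * h0) / 24
    simpa [hm] using this
  subst hp2
  exact ⟨rfl, by linear_combination (h1 + h2 - 2 * h0) / 2, by linear_combination (h1 - h2) / 2⟩

/-- The line through the vertex in the direction of `a` is the only symmetry axis of the parabola
`Q + t e + t² a`. -/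
theorem IsSymmetryAxis.eq_mk'_span {a e Q : EuclideanSpace ℝ (Fin 2)} (ha : a ≠ 0) (he : e ≠ 0)
    (hea : inner ℝ e a = 0) {ℓ : AffineSubspace ℝ (EuclideanSpace ℝ (Fin 2))}
    (h : IsSymmetryAxis (Set.range fun t : ℝ => Q + t • e + t ^ 2 • a) ℓ) :
    ℓ = AffineSubspace.mk' Q (Submodule.span ℝ {a}) := by
  obtain ⟨hfin, φ, hφ, hfix, himg⟩ := h
  have hV : Module.finrank ℝ (EuclideanSpace ℝ (Fin 2)) = 2 := by simp
  obtain ⟨x, hx⟩ : (ℓ : Set (EuclideanSpace ℝ (Fin 2))).Nonempty := by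
    rw [Set.nonempty_iff_ne_empty, Ne, AffineSubspace.coe_eq_bot_iff]
    rintro rfl
    rw [AffineSubspace.direction_bot, finrank_bot] at hfin
    exact zero_ne_one hfin
  have : Nonempty ℓ := ⟨⟨x, hx⟩⟩
  set R := ℓ.direction.reflection with hR
  have hφR : ∀ y, φ y = R (y - x) + x := fun y => by
    rw [eq_reflection_of_isometry_of_fixed_iff hV ℓ hfin hφ hfix,
      EuclideanGeometry.reflection_apply_of_mem ℓ y hx]
    rfl
  have hee : inner ℝ e e ≠ (0 : ℝ) := inner_self_ne_zero.2 he
  have haa : 0 < inner ℝ a a := real_inner_self_pos.2 ha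
  have hae : inner ℝ a e = 0 := by rw [real_inner_comm, hea]
  set w := R (Q - x) + x - Q with hw
  have hmem : ∀ t : ℝ, ∃ s : ℝ, w + t • R e + t ^ 2 • R a = s • e + s ^ 2 • a := by
    intro t
    obtain ⟨s, hs⟩ : φ (Q + t • e + t ^ 2 • a) ∈
        Set.range fun t : ℝ => Q + t • e + t ^ 2 • a := by
      rw [← himg]
      exact Set.mem_image_of_mem _ ⟨t, rfl⟩
    refine ⟨s, ?_⟩
    rw [hφR, show Q + t • e + t ^ 2 • a - x = (Q - x) + t • e + t ^ 2 • a by abel] at hs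
    simp only [map_add, map_smul] at hs
    rw [hw, show s • e + s ^ 2 • a = Q + s • e + s ^ 2 • a - Q by abel, hs]
    abel
  obtain ⟨hp2, hq2, hq1⟩ := quadratic_coeffs_of_eq_sq (m := inner ℝ a a) haa.ne'
    (k := inner ℝ e e ^ 2)
    (p0 := inner ℝ e w) (p1 := inner ℝ e (R e)) (p2 := inner ℝ e (R a))
    (q0 := inner ℝ a w) (q1 := inner ℝ a (R e)) (q2 := inner ℝ a (R a)) fun t => by
      obtain ⟨s, hs⟩ := hmem t
      have h1 := congrArg (inner ℝ e) hs
      have h2 := congrArg (inner ℝ a) hs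
      simp only [inner_add_right, inner_smul_right, hea, hae] at h1 h2
      rw [h1, h2]
      ring
  obtain ⟨c, hc⟩ := exists_smul_eq_of_inner_eq_zero hV he ha hea hp2
  have hc0 : 0 ≤ c := by
    rw [← hc, inner_smul_right] at hq2
    have h1 : 0 < inner ℝ e e ^ 2 * inner ℝ a a := by positivity
    have h2 : 0 ≤ c * (inner ℝ e e ^ 2 * inner ℝ a a) := by
      rw [show c * (inner ℝ e e ^ 2 * inner ℝ a a) = inner ℝ a a * inner ℝ e (R e) ^ 2 by
        rw [← hq2]; ring]
      positivity
    exact nonneg_of_mul_nonneg_left h2 h1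
  have hRa : R a = a := by
    have hn : c * ‖a‖ = ‖a‖ := by
      rw [← Real.norm_of_nonneg hc0, ← norm_smul, hc, R.norm_map]
    rw [← hc, mul_eq_right₀ (norm_ne_zero_iff.2 ha) |>.1 hn, one_smul]
  have hdir : Submodule.span ℝ {a} = ℓ.direction := by
    refine Submodule.eq_of_le_of_finrank_eq ?_ (by rw [hfin, finrank_span_singleton ha])
    rw [Submodule.span_singleton_le_iff_mem]
    exact (Submodule.reflection_eq_self_iff a).1 hRa
  have hinner : ∀ v, inner ℝ a (R v) = inner ℝ a v := fun v => by
    nth_rw 1 [← hRa]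
    exact R.inner_map_map a v
  have hew : inner ℝ e w = 0 := by
    rw [hRa] at hq2
    rw [hinner, hae] at hq1
    have hRe : inner ℝ e (R e) ≠ 0 := by
      intro h0
      rw [h0] at hq2
      simp [he, ha] at hq2
    simpa [ha, hRe] using hq1.symm
  have hw0 : w = 0 := by
    obtain ⟨k, hk⟩ := exists_smul_eq_of_inner_eq_zero hV he ha hea hew
    have haw : inner ℝ a w = 0 := by
      rw [hw, add_sub_assoc, inner_add_right, hinner, ← inner_add_right]
      simp
    rw [← hk, inner_smul_right] at haw
    rw [← hk, (mul_eq_zero.1 haw).resolve_right haa.ne', zero_smul]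
  have hQ : Q ∈ ℓ := (hfix Q).1 (by rw [hφR, ← sub_eq_zero, ← hw, hw0])
  rw [hdir, AffineSubspace.mk'_eq hQ]

theorem bezier_parabola_unique_axis_direction
    (P0 P1 P2 : EuclideanSpace ℝ (Fin 2))
    (hindep : AffineIndependent ℝ ![P0, P1, P2])
    (P : ℝ → EuclideanSpace ℝ (Fin 2))
    (hP : ∀ u : ℝ, P u = (1 - u) ^ 2 • P0 + (2 * (1 - u) * u) • P1 + u ^ 2 • P2) :
    (∃! ℓ : AffineSubspace ℝ (EuclideanSpace ℝ (Fin 2)),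
      IsSymmetryAxis (Set.range P) ℓ) ∧
    (∀ ℓ : AffineSubspace ℝ (EuclideanSpace ℝ (Fin 2)),
      IsSymmetryAxis (Set.range P) ℓ →
        ℓ.direction = Submodule.span ℝ {P0 - 2 • P1 + P2}) := by
  obtain ⟨ha, Q, e, he, hea, hrange⟩ := exists_vertex_parametrization hindep
  rw [funext hP, hrange]
  refine ⟨⟨_, isSymmetryAxis_mk'_span ha hea, fun ℓ h => h.eq_mk'_span ha he hea⟩, fun ℓ h => ?_⟩
  rw [h.eq_mk'_span ha he hea, AffineSubspace.direction_mk']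
end
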